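/- Let f : [0,∞) → [0,∞) be monotonically increasing and superadditive with lim_{t→0⁺} f(t) = 0 and f(t) > 0 for all t > 0. Then the space B̄ endowed with the f-Prokhorov metric π_f is a complete and separable metric space: every π_f-Cauchy sequence in B̄ converges in π_f to a diagram in B̄, and B̄ contains a countable π_f-dense subset. -/

import Mathlib

open scoped ENNReal Classical

/-- A persistence diagram: a finite multiset of points strictly above the diagonal of `ℝ²`.
Distances in `ℝ × ℝ` are measured by the product (sup-norm, i.e. `p = ∞`) metric `dist`. -/
structure PD where
  pts : Multiset (ℝ × ℝ)
  birth_lt_death : ∀ x ∈ pts, x.1 < x.2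

/-- Orthogonal projection of a point onto the diagonal `Δ = {(t, t) : t ∈ ℝ}`. -/
noncomputable def diagProj (x : ℝ × ℝ) : ℝ × ℝ := ((x.1 + x.2) / 2, (x.1 + x.2) / 2)

/-- The distance of a matched pair: a pair of two diagonal points counts as distance `0`,
otherwise the distance in `ℝ × ℝ` is used. -/
noncomputable def pairCost (u v : ℝ × ℝ) : ℝ :=
  if u.1 = u.2 ∧ v.1 = v.2 then 0 else dist u v

/-- `P` encodes a matching, i.e. a bijection `η : X₀ ⊔ Y₀' → Y₀ ⊔ X₀'`, as the multiset of
matched pairs `(u, η u)`: its first marginal is `X₀ ⊔ Y₀'` and its second is `Y₀ ⊔ X₀'`. -/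
def IsMatching (X Y : PD) (P : Multiset ((ℝ × ℝ) × (ℝ × ℝ))) : Prop :=
  P.map Prod.fst = X.pts + Y.pts.map diagProj ∧
  P.map Prod.snd = Y.pts + X.pts.map diagProj

/-- The bottleneck profile `D_{X,Y}(t) = inf_η |{u : d(u, η u) > t}|`. -/
noncomputable def bprofile (X Y : PD) (t : ℝ) : ℝ≥0∞ :=
  ⨅ P : {P : Multiset ((ℝ × ℝ) × (ℝ × ℝ)) // IsMatching X Y P},
    ((Multiset.countP (fun uv => t < pairCost uv.1 uv.2) P.1 : ℕ) : ℝ≥0∞)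

/-- A diagram in the class `B̄`: a countable multiset of points in the closed half-plane
`{(b, d) : b ≤ d}` (represented as an `ℕ`-indexed family; points on the diagonal, of which
countably many copies are freely available for matching, are allowed and serve to pad
finite diagrams), such that for every `ε > 0` only finitely many points lie at distance
greater than `ε` from the diagonal `Δ`. -/
structure BarB where
  pts : ℕ → ℝ × ℝ
  birth_le_death : ∀ n, (pts n).1 ≤ (pts n).2
  finitePers : ∀ ε : ℝ, 0 < ε → {n | ε < dist (pts n) (diagProj (pts n))}.Finite

/-- The domain `X₀ ⊔ Y₀'` of a matching between diagrams `X, Y ∈ B̄`. -/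
noncomputable def matchDom (X Y : BarB) : ℕ ⊕ ℕ → ℝ × ℝ
  | Sum.inl n => X.pts n
  | Sum.inr n => diagProj (Y.pts n)

/-- The codomain `Y₀ ⊔ X₀'` of a matching between diagrams `X, Y ∈ B̄`. -/
noncomputable def matchCod (X Y : BarB) : ℕ ⊕ ℕ → ℝ × ℝ
  | Sum.inl n => Y.pts n
  | Sum.inr n => diagProj (X.pts n)

/-- The bottleneck profile `D_{X,Y}(t) = inf_η |{u : d(u, η u) > t}|` for diagrams in `B̄`;
matchings are bijections `η : X₀ ⊔ Y₀' → Y₀ ⊔ X₀'`. -/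
noncomputable def bprofileB (X Y : BarB) (t : ℝ) : ℝ≥0∞ :=
  ⨅ e : ℕ ⊕ ℕ ≃ ℕ ⊕ ℕ,
    ({i | t < pairCost (matchDom X Y i) (matchCod X Y (e i))}.encard : ℝ≥0∞)

/-- The `f`-Prokhorov distance `π_f(X,Y) = inf {t > 0 : D_{X,Y}(t) < f(t)}` on `B̄`. -/
noncomputable def prokhorovB (f : ℝ → ℝ) (X Y : BarB) : ℝ≥0∞ :=
  ⨅ t : {t : ℝ // 0 < t ∧ bprofileB X Y t < ENNReal.ofReal (f t)}, ENNReal.ofReal t.1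

/-- The indices of the off-diagonal points of a diagram in `B̄`. -/
def BarB.offDiag (X : BarB) : Set ℕ := {n | (X.pts n).1 < (X.pts n).2}

/-- Equality of diagrams in `B̄` as multisets of off-diagonal points: there is a bijection
between the off-diagonal points of `X` and those of `Y` matching equal points. -/
def BarB.MEquiv (X Y : BarB) : Prop :=
  ∃ σ : X.offDiag ≃ Y.offDiag, ∀ n : X.offDiag, Y.pts (σ n : ℕ) = X.pts (n : ℕ)

/-- The `p`-Wasserstein distance `W_p(X,Y) = inf_η (Σ_u d(u, η u)^p)^(1/p)` on `B̄`. -/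
noncomputable def wassersteinB (p : ℝ) (X Y : BarB) : ℝ≥0∞ :=
  ⨅ e : ℕ ⊕ ℕ ≃ ℕ ⊕ ℕ,
    (∑' i, ENNReal.ofReal (pairCost (matchDom X Y i) (matchCod X Y (e i)) ^ p)) ^ (1 / p)

/-- The empty persistence diagram, viewed in `B̄` (only diagonal padding points). -/
noncomputable def emptyB : BarB where
  pts _ := (0, 0)
  birth_le_death _ := le_refl 0
  finitePers ε hε := by
    have : {n : ℕ | ε < dist ((0 : ℝ), (0 : ℝ)) (diagProj (0, 0))} = ∅ := by
      ext n
      simp [diagProj]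
      linarith
    simp only [this]
    exact Set.finite_empty

theorem dist_diagProj (x : ℝ × ℝ) : dist x (diagProj x) = |x.2 - x.1| / 2 := by
  have h₁ : x.1 - (x.1 + x.2) / 2 = -((x.2 - x.1) / 2) := by ring
  have h₂ : x.2 - (x.1 + x.2) / 2 = (x.2 - x.1) / 2 := by ring
  rw [Prod.dist_eq, diagProj, Real.dist_eq, Real.dist_eq, h₁, h₂, abs_neg, max_self, abs_div,
    abs_two]

theorem dist_diagProj_le_add (u v : ℝ × ℝ) :
    dist u (diagProj u) ≤ dist v (diagProj v) + dist u v := by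
  rw [dist_diagProj, dist_diagProj, Prod.dist_eq, Real.dist_eq, Real.dist_eq]
  have h₁ := le_max_left |u.1 - v.1| |u.2 - v.2|
  have h₂ := le_max_right |u.1 - v.1| |u.2 - v.2|
  have h₃ := abs_add_le (v.2 - v.1) ((u.2 - v.2) - (u.1 - v.1))
  have h₄ := abs_sub (u.2 - v.2) (u.1 - v.1)
  rw [show v.2 - v.1 + ((u.2 - v.2) - (u.1 - v.1)) = u.2 - u.1 by ring] at h₃
  linarith

theorem dist_diagProj_of_eq {x : ℝ × ℝ} (h : x.1 = x.2) : dist x (diagProj x) = 0 := by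
  simp [dist_diagProj, h]

theorem diagProj_fst_eq_snd (x : ℝ × ℝ) : (diagProj x).1 = (diagProj x).2 := rfl

theorem diagProj_of_eq {x : ℝ × ℝ} (h : x.1 = x.2) : diagProj x = x :=
  (dist_eq_zero.1 (dist_diagProj_of_eq h)).symm

/-- A partial matching `R` of the points of `X` and `Y` moving matched points by at most `t` and
leaving only points at distance at most `t` from the diagonal unmatched. -/
structure IsPartialMatching (X Y : BarB) (t : ℝ) (R : ℕ → ℕ → Prop) : Prop where
  biUnique : Relator.BiUnique R
  dist_le : ∀ n m, R n m → dist (X.pts n) (Y.pts m) ≤ t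
  left_le : ∀ n, (¬ ∃ m, R n m) → dist (X.pts n) (diagProj (X.pts n)) ≤ t
  right_le : ∀ m, (¬ ∃ n, R n m) → dist (Y.pts m) (diagProj (Y.pts m)) ≤ t

theorem IsPartialMatching.comp {X Y Z : BarB} {s t : ℝ} {R S : ℕ → ℕ → Prop}
    (hs : 0 ≤ s) (ht : 0 ≤ t) (hR : IsPartialMatching X Y s R) (hS : IsPartialMatching Y Z t S) :
    IsPartialMatching X Z (s + t) (Relation.Comp R S) where
  biUnique := by
    constructor
    · rintro a b c ⟨m, h₁, h₂⟩ ⟨m', h₃, h₄⟩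
      obtain rfl := hS.biUnique.1 h₂ h₄
      exact hR.biUnique.1 h₁ h₃
    · rintro a b c ⟨m, h₁, h₂⟩ ⟨m', h₃, h₄⟩
      obtain rfl := hR.biUnique.2 h₁ h₃
      exact hS.biUnique.2 h₂ h₄
  dist_le := by
    rintro n l ⟨m, h₁, h₂⟩
    exact (dist_triangle _ _ _).trans (add_le_add (hR.dist_le n m h₁) (hS.dist_le m l h₂))
  left_le n hn := by
    by_cases h : ∃ m, R n m
    · obtain ⟨m, hm⟩ := h
      have h₁ := hS.left_le m fun ⟨l, hl⟩ => hn ⟨l, m, hm, hl⟩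
      have h₂ := hR.dist_le n m hm
      have h₃ := dist_diagProj_le_add (X.pts n) (Y.pts m)
      linarith
    · linarith [hR.left_le n h]
  right_le l hl := by
    by_cases h : ∃ m, S m l
    · obtain ⟨m, hm⟩ := h
      have h₁ := hR.right_le m fun ⟨n, hn⟩ => hl ⟨n, m, hn, hm⟩
      have h₂ := hS.dist_le m l hm
      have h₃ := dist_diagProj_le_add (Z.pts l) (Y.pts m)
      rw [dist_comm (Z.pts l) (Y.pts m)] at h₃
      linarith
    · linarith [hS.right_le l h]

/-- The extension of a partial matching to `ℕ ⊕ ℕ`: a matched pair of points is accompanied by the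
reversed pair of their projections, and an unmatched point is paired with its own projection. -/
noncomputable def extendMatching (R : ℕ → ℕ → Prop) : ℕ ⊕ ℕ → ℕ ⊕ ℕ
  | Sum.inl n => if h : ∃ m, R n m then Sum.inl h.choose else Sum.inr n
  | Sum.inr m => if h : ∃ n, R n m then Sum.inr h.choose else Sum.inl m

theorem extendMatching_inl {R : ℕ → ℕ → Prop} (hR : Relator.BiUnique R) {n m : ℕ} (h : R n m) :
    extendMatching R (Sum.inl n) = Sum.inl m := by
  have h' : ∃ m, R n m := ⟨m, h⟩
  rw [extendMatching, dif_pos h', hR.2 h'.choose_spec h]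

theorem extendMatching_inr {R : ℕ → ℕ → Prop} (hR : Relator.BiUnique R) {n m : ℕ} (h : R n m) :
    extendMatching R (Sum.inr m) = Sum.inr n := by
  have h' : ∃ n, R n m := ⟨n, h⟩
  rw [extendMatching, dif_pos h', hR.1 h'.choose_spec h]

theorem extendMatching_inl_of_not {R : ℕ → ℕ → Prop} {n : ℕ} (h : ¬ ∃ m, R n m) :
    extendMatching R (Sum.inl n) = Sum.inr n := dif_neg h

theorem extendMatching_inr_of_not {R : ℕ → ℕ → Prop} {m : ℕ} (h : ¬ ∃ n, R n m) :
    extendMatching R (Sum.inr m) = Sum.inl m := dif_neg h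

theorem biUnique_flip {R : ℕ → ℕ → Prop} (hR : Relator.BiUnique R) : Relator.BiUnique (flip R) :=
  ⟨fun _ _ _ h h' => hR.right h h', fun _ _ _ h h' => hR.left h h'⟩

theorem extendMatching_flip_leftInverse {R : ℕ → ℕ → Prop} (hR : Relator.BiUnique R) :
    Function.LeftInverse (extendMatching (flip R)) (extendMatching R) := by
  have hR' := biUnique_flip hR
  rintro (n | m)
  · by_cases h : ∃ m, R n m
    · obtain ⟨m, h⟩ := h
      rw [extendMatching_inl hR h, extendMatching_inl hR' h]
    · rw [extendMatching_inl_of_not h, extendMatching_inr_of_not h]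
  · by_cases h : ∃ n, R n m
    · obtain ⟨n, h⟩ := h
      rw [extendMatching_inr hR h, extendMatching_inr hR' h]
    · rw [extendMatching_inr_of_not h, extendMatching_inl_of_not h]

theorem pairCost_le_dist (u v : ℝ × ℝ) : pairCost u v ≤ dist u v := by
  unfold pairCost
  split_ifs
  · exact dist_nonneg
  · exact le_rfl

theorem IsPartialMatching.exists_equiv {X Y : BarB} {t : ℝ} {R : ℕ → ℕ → Prop} (ht : 0 ≤ t)
    (hR : IsPartialMatching X Y t R) :
    ∃ e : ℕ ⊕ ℕ ≃ ℕ ⊕ ℕ, ∀ i, pairCost (matchDom X Y i) (matchCod X Y (e i)) ≤ t := by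
  have hB := hR.biUnique
  have hinv : Function.RightInverse (extendMatching (flip R)) (extendMatching R) :=
    extendMatching_flip_leftInverse (biUnique_flip hB)
  refine ⟨⟨extendMatching R, extendMatching (flip R), extendMatching_flip_leftInverse hB, hinv⟩,
    fun i => ?_⟩
  change pairCost (matchDom X Y i) (matchCod X Y (extendMatching R i)) ≤ t
  rcases i with n | m
  · by_cases h : ∃ m, R n m
    · obtain ⟨m, h⟩ := h
      rw [extendMatching_inl hB h]
      exact (pairCost_le_dist _ _).trans (hR.dist_le n m h)
    · rw [extendMatching_inl_of_not h]
      exact (pairCost_le_dist _ _).trans (hR.left_le n h)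
  · by_cases h : ∃ n, R n m
    · obtain ⟨n, h⟩ := h
      rw [extendMatching_inr hB h, matchDom, matchCod, pairCost,
        if_pos ⟨diagProj_fst_eq_snd _, diagProj_fst_eq_snd _⟩]
      exact ht
    · rw [extendMatching_inr_of_not h]
      refine (pairCost_le_dist _ _).trans ?_
      rw [dist_comm]
      exact hR.right_le m h

theorem exists_isPartialMatching {X Y : BarB} {t : ℝ} (ht : 0 ≤ t) (e : ℕ ⊕ ℕ ≃ ℕ ⊕ ℕ)
    (he : ∀ i, pairCost (matchDom X Y i) (matchCod X Y (e i)) ≤ t) :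
    ∃ R, IsPartialMatching X Y t R := by
  refine ⟨fun n m => e (Sum.inl n) = Sum.inl m ∧
    ¬ ((X.pts n).1 = (X.pts n).2 ∧ (Y.pts m).1 = (Y.pts m).2), ⟨?_, ?_⟩, ?_, ?_, ?_⟩
  · rintro a b c ⟨h₁, -⟩ ⟨h₂, -⟩
    exact Sum.inl_injective (e.injective (h₁.trans h₂.symm))
  · rintro a b c ⟨h₁, -⟩ ⟨h₂, -⟩
    exact Sum.inl_injective (h₁.symm.trans h₂)
  · rintro n m ⟨h₁, h₂⟩
    have h := he (Sum.inl n)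
    rwa [h₁, matchDom, matchCod, pairCost, if_neg h₂] at h
  · intro n hn
    by_cases hd : (X.pts n).1 = (X.pts n).2
    · rwa [dist_diagProj_of_eq hd]
    have h := he (Sum.inl n)
    rcases hm : e (Sum.inl n) with m | m
    · exact absurd ⟨m, hm, fun h => hd h.1⟩ hn
    · rw [hm, matchDom, matchCod, pairCost, if_neg fun h => hd h.1] at h
      have h₃ := dist_diagProj_le_add (X.pts n) (diagProj (X.pts m))
      rw [dist_diagProj_of_eq (diagProj_fst_eq_snd _)] at h₃
      linarith
  · intro m hm
    by_cases hd : (Y.pts m).1 = (Y.pts m).2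
    · rwa [dist_diagProj_of_eq hd]
    obtain ⟨i, hi⟩ := e.surjective (Sum.inl m)
    have h := he i
    rcases i with n | n
    · exact absurd ⟨n, hi, fun h => hd h.2⟩ hm
    · rw [hi, matchDom, matchCod, pairCost, if_neg fun h => hd h.2] at h
      have h₃ := dist_diagProj_le_add (Y.pts m) (diagProj (Y.pts n))
      rw [dist_diagProj_of_eq (diagProj_fst_eq_snd _), dist_comm (Y.pts m) (diagProj (Y.pts n))] at h₃
      linarith

theorem IsPartialMatching.prokhorovB_le {f : ℝ → ℝ} {X Y : BarB} {t : ℝ} {R : ℕ → ℕ → Prop}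
    (ht : 0 < t) (hft : 0 < f t) (hR : IsPartialMatching X Y t R) :
    prokhorovB f X Y ≤ ENNReal.ofReal t := by
  obtain ⟨e, he⟩ := hR.exists_equiv ht.le
  refine iInf_le_of_le ⟨t, ht, ?_⟩ le_rfl
  refine (iInf_le _ e).trans_lt ?_
  have h : {i | t < pairCost (matchDom X Y i) (matchCod X Y (e i))} = ∅ :=
    Set.eq_empty_iff_forall_notMem.2 fun i hi => (he i).not_gt hi
  simpa [h] using hft

theorem exists_isPartialMatching_of_prokhorovB_lt {f : ℝ → ℝ} {X Y : BarB} {δ : ℝ}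
    (hf : ∀ t, 0 < t → t < δ → f t ≤ 1) (h : prokhorovB f X Y < ENNReal.ofReal δ) :
    ∃ R, IsPartialMatching X Y δ R := by
  obtain ⟨⟨t, ht, hD⟩, htδ⟩ := iInf_lt_iff.1 h
  have htδ : t < δ := (ENNReal.ofReal_lt_ofReal_iff_of_nonneg ht.le).1 htδ
  obtain ⟨e, he⟩ := iInf_lt_iff.1 hD
  have h1 := he.trans_le (ENNReal.ofReal_le_one.2 (hf t ht htδ))
  have h2 : {i | t < pairCost (matchDom X Y i) (matchCod X Y (e i))}.encard < 1 := by
    exact_mod_cast h1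
  rw [Order.lt_one_iff, Set.encard_eq_zero] at h2
  refine exists_isPartialMatching (ht.le.trans htδ.le) e fun i => ?_
  have h3 : ¬ t < pairCost (matchDom X Y i) (matchCod X Y (e i)) :=
    Set.eq_empty_iff_forall_notMem.1 h2 i
  exact (not_lt.1 h3).trans htδ.le

/-- The label `(k, n)` of a point in a sequence of partially matched diagrams records that it
descends from the `n`-th point of the `k`-th diagram, which has no predecessor itself. -/
noncomputable def label (R : ℕ → ℕ → ℕ → Prop) : ℕ → ℕ → ℕ × ℕ
  | 0, n => (0, n)
  | k + 1, m => if h : ∃ n, R k n m then label R k h.choose else (k + 1, m)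

theorem label_succ_of_rel {R : ℕ → ℕ → ℕ → Prop} {k n m : ℕ} (hR : Relator.BiUnique (R k))
    (h : R k n m) : label R (k + 1) m = label R k n := by
  have h' : ∃ n, R k n m := ⟨n, h⟩
  rw [label, dif_pos h', hR.1 h'.choose_spec h]

theorem label_succ_of_not {R : ℕ → ℕ → ℕ → Prop} {k m : ℕ} (h : ¬ ∃ n, R k n m) :
    label R (k + 1) m = (k + 1, m) := by
  rw [label, dif_neg h]

theorem label_fst_le (R : ℕ → ℕ → ℕ → Prop) (k n : ℕ) : (label R k n).1 ≤ k := by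
  induction k generalizing n with
  | zero => exact le_rfl
  | succ k ih =>
    rw [label]
    split_ifs
    · exact (ih _).trans k.le_succ
    · exact le_rfl

theorem label_injective {R : ℕ → ℕ → ℕ → Prop} (hR : ∀ k, Relator.BiUnique (R k)) (k : ℕ) :
    Function.Injective (label R k) := by
  induction k with
  | zero => exact fun a b h => congrArg Prod.snd h
  | succ k ih =>
    have aux : ∀ a b, (∃ n, R k n a) → (¬ ∃ n, R k n b) →
        label R (k + 1) a ≠ label R (k + 1) b := by
      rintro a b ⟨n, hn⟩ hb h
      rw [label_succ_of_rel (hR k) hn, label_succ_of_not hb] at h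
      have := label_fst_le R k n
      rw [h] at this
      exact absurd this (Nat.not_succ_le_self k)
    intro a b h
    by_cases ha : ∃ n, R k n a <;> by_cases hb : ∃ n, R k n b
    · obtain ⟨n, hn⟩ := ha
      obtain ⟨n', hn'⟩ := hb
      rw [label_succ_of_rel (hR k) hn, label_succ_of_rel (hR k) hn'] at h
      obtain rfl := ih h
      exact (hR k).2 hn hn'
    · exact absurd h (aux a b ha hb)
    · exact absurd h.symm (aux b a hb ha)
    · rw [label_succ_of_not ha, label_succ_of_not hb] at h
      exact congrArg Prod.snd h

/-- The position at time `k` of the point with a given label: on the diagonal before its birth and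
after its death, and at the corresponding point of `X k` in between. -/
noncomputable def track (X : ℕ → BarB) (R : ℕ → ℕ → ℕ → Prop) : ℕ → ℕ × ℕ → ℝ × ℝ
  | 0, j => if j.1 = 0 then (X 0).pts j.2 else diagProj ((X j.1).pts j.2)
  | k + 1, j => if h : ∃ m, label R (k + 1) m = j then (X (k + 1)).pts h.choose
      else diagProj (track X R k j)

section track

variable {X : ℕ → BarB} {R : ℕ → ℕ → ℕ → Prop}

theorem track_succ_of_not {k : ℕ} {j : ℕ × ℕ} (h : ¬ ∃ m, label R (k + 1) m = j) :
    track X R (k + 1) j = diagProj (track X R k j) := by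
  rw [track, dif_neg h]

theorem track_label (hR : ∀ k, Relator.BiUnique (R k)) (k n : ℕ) :
    track X R k (label R k n) = (X k).pts n := by
  cases k with
  | zero => rfl
  | succ k =>
    have h : ∃ m, label R (k + 1) m = label R (k + 1) n := ⟨n, rfl⟩
    rw [track, dif_pos h, label_injective hR (k + 1) h.choose_spec]

theorem track_of_lt {k : ℕ} {j : ℕ × ℕ} (h : k < j.1) :
    track X R k j = diagProj ((X j.1).pts j.2) := by
  induction k with
  | zero => exact if_neg h.ne'
  | succ k ih =>
    rw [track_succ_of_not, ih (k.lt_succ_self.trans h), diagProj_of_eq (diagProj_fst_eq_snd _)]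
    rintro ⟨m, rfl⟩
    exact h.not_ge (label_fst_le R _ _)

theorem track_fst_eq_snd {k : ℕ} {j : ℕ × ℕ} (h : ¬ ∃ m, label R k m = j) :
    (track X R k j).1 = (track X R k j).2 := by
  cases k with
  | zero =>
    have hj : j.1 ≠ 0 := fun h0 => h ⟨j.2, Prod.ext h0.symm rfl⟩
    rw [track, if_neg hj]
    exact diagProj_fst_eq_snd _
  | succ k =>
    rw [track_succ_of_not h]
    exact diagProj_fst_eq_snd _

theorem track_fst_le_snd (hR : ∀ k, Relator.BiUnique (R k)) (k : ℕ) (j : ℕ × ℕ) :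
    (track X R k j).1 ≤ (track X R k j).2 := by
  by_cases h : ∃ m, label R k m = j
  · obtain ⟨m, rfl⟩ := h
    rw [track_label hR]
    exact (X k).birth_le_death m
  · exact (track_fst_eq_snd h).le

theorem dist_track_succ_le {t : ℕ → ℝ} (ht : ∀ k, 0 ≤ t k)
    (hR : ∀ k, IsPartialMatching (X k) (X (k + 1)) (t k) (R k)) (k : ℕ) (j : ℕ × ℕ) :
    dist (track X R k j) (track X R (k + 1) j) ≤ t k := by
  have hB := fun k => (hR k).biUnique
  by_cases h : ∃ m, label R (k + 1) m = j
  · obtain ⟨m, rfl⟩ := h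
    rw [track_label hB]
    by_cases hm : ∃ n, R k n m
    · obtain ⟨n, hn⟩ := hm
      rw [label_succ_of_rel (hB k) hn, track_label hB]
      exact (hR k).dist_le n m hn
    · rw [label_succ_of_not hm, track_of_lt k.lt_succ_self, dist_comm]
      exact (hR k).right_le m hm
  · rw [track_succ_of_not h]
    by_cases h' : ∃ n, label R k n = j
    · obtain ⟨n, rfl⟩ := h'
      rw [track_label hB]
      exact (hR k).left_le n fun ⟨m, hm⟩ => h ⟨m, label_succ_of_rel (hB k) hm⟩
    · rw [dist_diagProj_of_eq (track_fst_eq_snd h')]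
      exact ht k

end track

theorem exists_limit_of_isPartialMatching {X : ℕ → BarB} {R : ℕ → ℕ → ℕ → Prop}
    (hR : ∀ k, IsPartialMatching (X k) (X (k + 1)) (1 / 2 ^ k) (R k)) :
    ∃ L : BarB, ∀ k, ∃ S, IsPartialMatching (X k) L (2 / 2 ^ k) S := by
  have hB := fun k => (hR k).biUnique
  have hstep : ∀ j k, dist (track X R k j) (track X R (k + 1) j) ≤ 2 / 2 / 2 ^ k := fun j k => by
    simpa using dist_track_succ_le (fun k => by positivity) hR k j
  choose p hp using fun j => cauchySeq_tendsto_of_complete (cauchySeq_of_le_geometric_two (hstep j))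
  have hdist : ∀ j k, dist (track X R k j) (p j) ≤ 2 / 2 ^ k := fun j k =>
    dist_le_of_le_geometric_two_of_tendsto (hstep j) (hp j) k
  let c := Nat.pairEquiv
  refine ⟨⟨fun i => p (c.symm i), fun i => ?_, fun ε hε => ?_⟩, fun k =>
    ⟨fun n i => label R k n = c.symm i, ⟨?_, ?_⟩, ?_, ?_, ?_⟩⟩
  · exact le_of_tendsto_of_tendsto'
      ((continuous_fst.tendsto _).comp (hp _)) ((continuous_snd.tendsto _).comp (hp _))
      fun k => track_fst_le_snd hB k _
  · obtain ⟨k, hk⟩ := exists_pow_lt_of_lt_one (show 0 < ε / 4 by positivity) one_half_lt_one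
    have hk' : (2 : ℝ) / 2 ^ k < ε / 2 := by
      rw [one_div, inv_pow] at hk
      rw [div_eq_mul_inv]
      linarith
    refine (((X k).finitePers (ε / 2) (by positivity)).image fun n => c (label R k n)).subset ?_
    intro i hi
    have h₁ := dist_diagProj_le_add (p (c.symm i)) (track X R k (c.symm i))
    rw [dist_comm (p (c.symm i)) (track X R k (c.symm i))] at h₁
    have h₂ := hdist (c.symm i) k
    have hi : ε < dist (p (c.symm i)) (diagProj (p (c.symm i))) := hi
    by_cases h : ∃ n, label R k n = c.symm i
    · obtain ⟨n, hn⟩ := h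
      refine ⟨n, ?_, by simp [hn]⟩
      rw [← hn, track_label hB, hn] at h₁
      change ε / 2 < _
      rw [← hn, track_label hB, hn] at h₂
      linarith
    · rw [dist_diagProj_of_eq (track_fst_eq_snd h)] at h₁
      linarith
  · intro a b i h₁ h₂
    exact label_injective hB k (h₁.trans h₂.symm)
  · intro n a b h₁ h₂
    exact c.symm.injective (h₁.symm.trans h₂)
  · intro n i h
    rw [← track_label hB k n, h]
    exact hdist _ k
  · intro n h
    exact absurd ⟨c (label R k n), (c.symm_apply_apply _).symm⟩ h
  · intro i h
    have h₁ := dist_diagProj_le_add (p (c.symm i)) (track X R k (c.symm i))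
    rw [dist_comm (p (c.symm i)) (track X R k (c.symm i)),
      dist_diagProj_of_eq (track_fst_eq_snd h), zero_add] at h₁
    exact h₁.trans (hdist _ k)

/-- The diagram with finitely many points obtained by ordering the coordinates of each of the
given rational points, padded by the origin. -/
noncomputable def rationalDiagram (q : Σ N : ℕ, Fin N → ℚ × ℚ) : BarB where
  pts n := if h : n < q.1 then
    (min ((q.2 ⟨n, h⟩).1 : ℝ) (q.2 ⟨n, h⟩).2, max ((q.2 ⟨n, h⟩).1 : ℝ) (q.2 ⟨n, h⟩).2) else 0
  birth_le_death n := by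
    split_ifs
    · exact min_le_max
    · exact le_rfl
  finitePers ε hε := by
    refine (Set.finite_lt_nat q.1).subset fun n hn => ?_
    by_contra h
    have hn : ε < _ := hn
    rw [dif_neg (show ¬ n < q.1 from h), dist_diagProj_of_eq rfl] at hn
    exact hn.not_gt hε

theorem exists_rationalDiagram_isPartialMatching (X : BarB) {t : ℝ} (ht : 0 < t) :
    ∃ q R, IsPartialMatching X (rationalDiagram q) t R := by
  obtain ⟨N, hN⟩ := (X.finitePers t ht).bddAbove
  choose a ha using fun x : ℝ => Rat.denseRange_cast.exists_dist_lt x ht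
  let q : Σ N : ℕ, Fin N → ℚ × ℚ := ⟨N + 1, fun n => (a (X.pts n).1, a (X.pts n).2)⟩
  refine ⟨q, fun n m => n = m ∧ n < N + 1, ⟨?_, ?_⟩, ?_, ?_, ?_⟩
  · rintro a b c ⟨rfl, -⟩ ⟨rfl, -⟩
    rfl
  · rintro a b c ⟨rfl, -⟩ ⟨rfl, -⟩
    rfl
  · rintro n _ ⟨rfl, hn⟩
    have hpt : (rationalDiagram q).pts n = (min (a (X.pts n).1 : ℝ) (a (X.pts n).2),
        max (a (X.pts n).1 : ℝ) (a (X.pts n).2)) := dif_pos hn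
    have hX := X.birth_le_death n
    have h₁ := (ha (X.pts n).1).le
    have h₂ := (ha (X.pts n).2).le
    rw [Real.dist_eq] at h₁ h₂
    rw [hpt, Prod.dist_eq, Real.dist_eq, Real.dist_eq]
    refine max_le ?_ ?_
    · nth_rewrite 1 [← min_eq_left hX]
      exact (abs_min_sub_min_le_max _ _ _ _).trans (max_le h₁ h₂)
    · nth_rewrite 1 [← max_eq_right hX]
      exact (abs_max_sub_max_le_max _ _ _ _).trans (max_le h₁ h₂)
  · intro n hn
    by_contra h
    exact hn ⟨n, rfl, Nat.lt_succ_of_le (hN (not_le.1 h))⟩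
  · intro m hm
    have hpt : (rationalDiagram q).pts m = 0 := dif_neg fun h => hm ⟨m, rfl, h⟩
    rw [hpt, dist_diagProj_of_eq rfl]
    exact ht.le

/-- The space `B̄` with the `f`-Prokhorov metric is polish: every `π_f`-Cauchy sequence
in `B̄` converges in `π_f` to a diagram in `B̄` (completeness), and `B̄` contains a
countable `π_f`-dense subset (separability). -/
theorem barB_prokhorov_polish (f : ℝ → ℝ)
    (hf_nonneg : ∀ t, 0 ≤ t → 0 ≤ f t)
    (hf_mono : ∀ s t, 0 ≤ s → s ≤ t → f s ≤ f t)
    (hf_superadd : ∀ s t, 0 ≤ s → 0 ≤ t → f s + f t ≤ f (s + t))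
    (hf_lim : Filter.Tendsto f (nhdsWithin 0 (Set.Ioi 0)) (nhds 0))
    (hf_pos : ∀ t, 0 < t → 0 < f t) :
    (∀ X : ℕ → BarB,
      (∀ ε : ℝ, 0 < ε → ∃ N : ℕ, ∀ m ≥ N, ∀ n ≥ N,
        prokhorovB f (X m) (X n) < ENNReal.ofReal ε) →
      ∃ L : BarB, ∀ ε : ℝ, 0 < ε → ∃ N : ℕ, ∀ n ≥ N,
        prokhorovB f (X n) L < ENNReal.ofReal ε) ∧
    (∃ S : Set BarB, S.Countable ∧
      ∀ X : BarB, ∀ ε : ℝ, 0 < ε → ∃ Z ∈ S, prokhorovB f X Z < ENNReal.ofReal ε) := by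
  constructor
  · intro X hX
    obtain ⟨δ, hδ, hfδ⟩ : ∃ δ : ℝ, 0 < δ ∧ ∀ t, 0 < t → t < δ → f t ≤ 1 := by
      obtain ⟨δ, hδ, h⟩ := mem_nhdsGT_iff_exists_Ioo_subset.1
        (hf_lim.eventually (eventually_le_nhds (zero_lt_one' ℝ)))
      exact ⟨δ, hδ, fun t h₁ h₂ => h ⟨h₁, h₂⟩⟩
    have hmatch : ∀ k : ℕ, ∃ N, ∀ m ≥ N, ∀ n ≥ N,
        ∃ R, IsPartialMatching (X m) (X n) (1 / 2 ^ k) R := fun k => by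
      obtain ⟨N, hN⟩ := hX (min δ (1 / 2 ^ k)) (lt_min hδ (by positivity))
      refine ⟨N, fun m hm n hn => ?_⟩
      obtain ⟨R, hR⟩ := exists_isPartialMatching_of_prokhorovB_lt
        (fun t h₁ h₂ => hfδ t h₁ (h₂.trans_le (min_le_left _ _))) (hN m hm n hn)
      exact ⟨R, hR.biUnique, fun n m h => (hR.dist_le n m h).trans (min_le_right _ _),
        fun n h => (hR.left_le n h).trans (min_le_right _ _),
        fun m h => (hR.right_le m h).trans (min_le_right _ _)⟩
    choose N hN using hmatch
    let φ : ℕ → ℕ := fun k => ∑ i ∈ Finset.range (k + 1), N i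
    have hφ : ∀ k l, k ≤ l → N k ≤ φ l := fun k l h =>
      Finset.single_le_sum (f := N) (fun _ _ => Nat.zero_le _)
        (Finset.mem_range.2 (Nat.lt_succ_of_le h))
    choose R hR using fun k => hN k (φ k) (hφ k k le_rfl) (φ (k + 1)) (hφ k (k + 1) k.le_succ)
    obtain ⟨L, hL⟩ := exists_limit_of_isPartialMatching (X := X ∘ φ) hR
    refine ⟨L, fun ε hε => ?_⟩
    obtain ⟨k, hk⟩ := exists_pow_lt_of_lt_one (show 0 < ε / 3 by positivity) one_half_lt_one
    have hk' : (1 : ℝ) / 2 ^ k + 2 / 2 ^ k < ε := by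
      rw [one_div, inv_pow] at hk
      rw [div_eq_mul_inv, div_eq_mul_inv]
      linarith
    refine ⟨N k, fun n hn => ?_⟩
    obtain ⟨S, hS⟩ := hN k n hn (φ k) (hφ k k le_rfl)
    obtain ⟨T, hT⟩ := hL k
    have hpos : (0 : ℝ) < 1 / 2 ^ k + 2 / 2 ^ k := by positivity
    exact ((hS.comp (by positivity) (by positivity) hT).prokhorovB_le hpos (hf_pos _ hpos)).trans_lt
      ((ENNReal.ofReal_lt_ofReal_iff hε).2 hk')
  · refine ⟨Set.range rationalDiagram, Set.countable_range _, fun X ε hε => ?_⟩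
    obtain ⟨q, R, hR⟩ := exists_rationalDiagram_isPartialMatching X (half_pos hε)
    exact ⟨_, ⟨q, rfl⟩, (hR.prokhorovB_le (half_pos hε) (hf_pos _ (half_pos hε))).trans_lt
      ((ENNReal.ofReal_lt_ofReal_iff hε).2 (half_lt_self hε))⟩
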